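/- arXiv:1709.10371 — 2 statements merged into one kernel-verified Lean document; each statement's English description precedes it below -/
import Mathlib

section
/- For every real number a with 0 ≤ a ≤ 1/2, h₂(a⋆a⋆a) ≥ h₂(a) + h₂(a⋆a)² · (1 − h₂(a)) ≥ h₂(a) + h₂(a)² · (1 − h₂(a))², where a⋆a = 2a(1−a) and a⋆a⋆a = (a⋆a)⋆a. -/
noncomputable def h2 (p : ℝ) : ℝ := -p * Real.logb 2 p - (1 - p) * Real.logb 2 (1 - p)

noncomputable def bconv (a b : ℝ) : ℝ := a * (1 - b) + b * (1 - a)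

lemma h2_eq_binEntropy (p : ℝ) : h2 p = Real.binEntropy p / Real.log 2 := by
  unfold h2 Real.binEntropy Real.logb
  rw [Real.log_inv, Real.log_inv]
  ring

lemma sinh_convex : ConvexOn ℝ (Set.Ici 0) Real.sinh := by
  apply MonotoneOn.convexOn_of_deriv (convex_Ici 0) Real.continuous_sinh.continuousOn
    Real.differentiable_sinh.differentiableOn
  rw [Real.deriv_sinh, interior_Ici]
  intro x hx y hy hxy
  rw [Real.cosh_le_cosh, abs_of_pos hx, abs_of_pos hy]
  exact hxy

lemma sinh_ratio {s t : ℝ} (hs : 0 ≤ s) (hst : s ≤ t) (ht : 0 < t) :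
    t * Real.sinh s ≤ s * Real.sinh t := by
  have w1 : 0 ≤ s / t := by positivity
  have w2 : 0 ≤ 1 - s / t := by rw [sub_nonneg, div_le_one ht]; exact hst
  have h := sinh_convex.2 (Set.mem_Ici.2 ht.le) (Set.mem_Ici.2 (le_refl (0:ℝ)))
    w1 w2 (by ring)
  simp only [smul_eq_mul, mul_zero, add_zero, Real.sinh_zero] at h
  rw [div_mul_cancel₀ _ ht.ne'] at h
  calc t * Real.sinh s ≤ t * (s / t * Real.sinh t) := by gcongr
    _ = s * Real.sinh t := by field_simp

noncomputable def tpar (s : ℝ) : ℝ := (Real.log (1 - s) - Real.log s) / 2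

lemma sinh_tpar {s : ℝ} (h0 : 0 < s) (h1 : s < 1) :
    2 * Real.sinh (tpar s) = (1 - 2 * s) / Real.sqrt (s * (1 - s)) := by
  have hp : 0 < Real.sqrt s := Real.sqrt_pos.2 h0
  have hq : 0 < Real.sqrt (1 - s) := Real.sqrt_pos.2 (by linarith)
  have e : tpar s = Real.log (Real.sqrt (1 - s) / Real.sqrt s) := by
    rw [Real.log_div hq.ne' hp.ne', Real.log_sqrt (by linarith), Real.log_sqrt h0.le]
    unfold tpar; ring
  rw [e, Real.sinh_log (by positivity), Real.sqrt_mul h0.le]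
  have a1 : Real.sqrt s ^ 2 = s := Real.sq_sqrt h0.le
  have a2 : Real.sqrt (1 - s) ^ 2 = 1 - s := Real.sq_sqrt (by linarith)
  field_simp
  rw [a1, a2]; ring

noncomputable def ff (b : ℝ) : ℝ :=
  Real.log 2 * (2 * Real.sqrt (b * (1 - b))) - Real.binEntropy b

lemma ff_deriv {s : ℝ} (h0 : 0 < s) (h1 : s < 1) :
    HasDerivAt ff (2 * (Real.log 2 * Real.sinh (tpar s) - tpar s)) s := by
  have hpos : 0 < s * (1 - s) := mul_pos h0 (by linarith)
  have d1 : HasDerivAt (fun b : ℝ => b * (1 - b)) (1 * (1 - s) + s * (-1)) s :=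
    (hasDerivAt_id s).mul ((hasDerivAt_id s).const_sub 1)
  have d2 := ((d1.sqrt hpos.ne').const_mul 2).const_mul (Real.log 2)
  have d3 := d2.sub (Real.hasDerivAt_binEntropy h0.ne' h1.ne)
  refine d3.congr_deriv ?_
  have := sinh_tpar h0 h1
  have e : 2 * (Real.log 2 * Real.sinh (tpar s) - tpar s)
    = Real.log 2 * (2 * Real.sinh (tpar s)) - 2 * tpar s := by ring
  rw [e, this]
  unfold tpar
  ring

lemma ff_cont : Continuous ff := by
  unfold ff
  fun_prop

lemma ff_nonneg {b : ℝ} (h0 : 0 ≤ b) (h1 : b ≤ 1 / 2) : 0 ≤ ff b := by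
  have f0 : ff 0 = 0 := by simp [ff]
  have f1 : ff (1 / 2) = 0 := by
    have e : Real.sqrt ((1 / 2 : ℝ) * (1 - 1 / 2)) = 1 / 2 := by
      rw [show (1 / 2 : ℝ) * (1 - 1 / 2) = (1 / 2) ^ 2 by norm_num]
      exact Real.sqrt_sq (by norm_num)
    have e2 : Real.binEntropy (1 / 2) = Real.log 2 := by
      rw [one_div]; exact Real.binEntropy_two_inv
    unfold ff
    rw [e, e2]; ring
  by_contra! hneg
  have hb0 : 0 < b := lt_of_le_of_ne h0 (by rintro rfl; linarith)
  have hb1 : b < 1 / 2 := lt_of_le_of_ne h1 (by rintro rfl; linarith)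
  obtain ⟨s, hs, es⟩ := exists_hasDerivAt_eq_slope ff
    (fun s => 2 * (Real.log 2 * Real.sinh (tpar s) - tpar s)) hb0 ff_cont.continuousOn
    (fun x hx => ff_deriv hx.1 (by linarith [hx.2]))
  obtain ⟨r, hr, er⟩ := exists_hasDerivAt_eq_slope ff
    (fun s => 2 * (Real.log 2 * Real.sinh (tpar s) - tpar s)) hb1 ff_cont.continuousOn
    (fun x hx => ff_deriv (by linarith [hx.1]) (by linarith [hx.2]))
  have n1 : (ff b - ff 0) / (b - 0) < 0 := div_neg_of_neg_of_pos (by linarith) (by linarith)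
  have n2 : 0 < (ff (1 / 2) - ff b) / (1 / 2 - b) := div_pos (by linarith) (by linarith)
  rw [← es] at n1
  rw [← er] at n2
  obtain ⟨s0, s1⟩ := hs
  obtain ⟨r0, r1⟩ := hr
  have l1 : Real.log r < Real.log (1 - r) := Real.log_lt_log (by linarith) (by linarith)
  have l2 : Real.log s < Real.log r := Real.log_lt_log (by linarith) (by linarith)
  have l3 : Real.log (1 - r) < Real.log (1 - s) := Real.log_lt_log (by linarith) (by linarith)
  have t0 : 0 < tpar r := by unfold tpar; linarith
  have t1 : tpar r < tpar s := by unfold tpar; linarith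
  have key := sinh_ratio t0.le t1.le (t0.trans t1)
  have hl : 0 < Real.log 2 := Real.log_pos (by norm_num)
  have k1 : Real.log 2 * Real.sinh (tpar s) < tpar s := by linarith
  have k2 : tpar r < Real.log 2 * Real.sinh (tpar r) := by linarith
  have k3 := mul_lt_mul_of_pos_left k1 t0
  have k4 := mul_lt_mul_of_pos_left k2 (t0.trans t1)
  have k5 := mul_le_mul_of_nonneg_left key hl.le
  linarith

lemma h2_sq_le {b : ℝ} (h0 : 0 ≤ b) (h1 : b ≤ 1 / 2) : h2 b ^ 2 ≤ 4 * (b * (1 - b)) := by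
  have hl : 0 < Real.log 2 := Real.log_pos (by norm_num)
  have h := ff_nonneg h0 h1
  unfold ff at h
  have hb : h2 b ≤ 2 * Real.sqrt (b * (1 - b)) := by
    rw [h2_eq_binEntropy, div_le_iff₀ hl]; linarith
  have hn : 0 ≤ h2 b := by
    rw [h2_eq_binEntropy]
    exact div_nonneg (Real.binEntropy_nonneg h0 (by linarith)) hl.le
  have hs : Real.sqrt (b * (1 - b)) ^ 2 = b * (1 - b) :=
    Real.sq_sqrt (mul_nonneg h0 (by linarith))
  calc h2 b ^ 2 ≤ (2 * Real.sqrt (b * (1 - b))) ^ 2 := by gcongr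
    _ = _ := by rw [mul_pow, hs]; norm_num

lemma series_G {x : ℝ} (h0 : 0 ≤ x) (h1 : x < 1) :
    HasSum (fun k : ℕ => x ^ (2 * k + 2) / ((2 * k + 1) * (2 * k + 2)))
      (Real.log 2 - Real.binEntropy ((1 - x) / 2)) := by
  have s1 := (Real.hasSum_log_sub_log_of_abs_lt_one (x := x)
    (by rwa [abs_of_nonneg h0])).mul_left (x / 2)
  have hx2 : x ^ 2 < 1 := by nlinarith
  have s2 := (Real.hasSum_pow_div_log_of_abs_lt_one (x := x ^ 2)
    (by rwa [abs_of_nonneg (sq_nonneg x)])).mul_left (1 / 2)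
  have s3 := s1.sub s2
  convert! s3 using 1
  · funext k
    have e1 : (2 * (k:ℝ) + 1) ≠ 0 := by positivity
    have e2 : ((k:ℝ) + 1) ≠ 0 := by positivity
    field_simp
    ring
  · have a1 : (1 - x) ≠ 0 := by linarith
    have a2 : (1 + x) ≠ 0 := by linarith
    unfold Real.binEntropy
    rw [Real.log_inv, Real.log_inv, show 1 - (1 - x) / 2 = (1 + x) / 2 by ring,
      Real.log_div a1 two_ne_zero, Real.log_div a2 two_ne_zero,
      show 1 - x ^ 2 = (1 - x) * (1 + x) by ring, Real.log_mul a1 a2]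
    ring

lemma G_ineq {x : ℝ} (h0 : 0 ≤ x) (h1 : x < 1) :
    1 - h2 ((1 - x ^ 3) / 2) ≤ x ^ 4 * (1 - h2 ((1 - x) / 2)) := by
  have hl : 0 < Real.log 2 := Real.log_pos (by norm_num)
  have s1 := (series_G h0 h1).mul_left (x ^ 4)
  have s2 := series_G (x := x ^ 3) (by positivity) (pow_lt_one₀ h0 h1 (by norm_num))
  have h := hasSum_le (fun k => ?_) s2 s1
  · rw [h2_eq_binEntropy, h2_eq_binEntropy, one_sub_div hl.ne', one_sub_div hl.ne',
      ← mul_div_assoc]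
    gcongr
  · rw [← mul_div_assoc, ← pow_mul, ← pow_add]
    have hk : x ^ (3 * (2 * k + 2)) ≤ x ^ (4 + (2 * k + 2)) :=
      pow_le_pow_of_le_one h0 h1.le (by omega)
    exact div_le_div_of_nonneg_right hk (by positivity)

theorem entropy_threefold_selfconv (a : ℝ) (h0 : 0 ≤ a) (h1 : a ≤ 1 / 2) :
    h2 (bconv (bconv a a) a) ≥ h2 a + (h2 (bconv a a)) ^ 2 * (1 - h2 a) ∧
    h2 a + (h2 (bconv a a)) ^ 2 * (1 - h2 a) ≥ h2 a + (h2 a) ^ 2 * (1 - h2 a) ^ 2 := by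
  have hl : 0 < Real.log 2 := Real.log_pos (by norm_num)
  have hb0 : 0 ≤ bconv a a := by unfold bconv; nlinarith
  have hab : a ≤ bconv a a := by unfold bconv; nlinarith
  have hb1 : bconv a a ≤ 1 / 2 := by unfold bconv; nlinarith [sq_nonneg (1 - 2 * a)]
  have hn : 0 ≤ h2 a := by
    rw [h2_eq_binEntropy]
    exact div_nonneg (Real.binEntropy_nonneg h0 (by linarith)) hl.le
  have hle : h2 a ≤ 1 := by
    rw [h2_eq_binEntropy, div_le_one hl]; exact Real.binEntropy_le_log_two
  have hmono : h2 a ≤ h2 (bconv a a) := by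
    rw [h2_eq_binEntropy, h2_eq_binEntropy]
    gcongr
    exact Real.binEntropy_strictMonoOn.monotoneOn ⟨h0, by linarith⟩ ⟨hb0, by linarith⟩ hab
  constructor
  · rcases h0.eq_or_lt with rfl | hpos
    · simp [bconv, h2]
    · have g := G_ineq (x := 1 - 2 * a) (by linarith) (by linarith)
      rw [show (1 - (1 - 2 * a) ^ 3) / 2 = bconv (bconv a a) a by unfold bconv; ring,
        show (1 - (1 - 2 * a)) / 2 = a by ring] at g
      have hs := h2_sq_le hb0 hb1
      rw [show 4 * (bconv a a * (1 - bconv a a)) = 1 - (1 - 2 * a) ^ 4 by unfold bconv; ring] at hs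
      have := mul_le_mul_of_nonneg_right hs (sub_nonneg.2 hle)
      linarith
  · have e1 : h2 a ^ 2 ≤ h2 (bconv a a) ^ 2 := by gcongr
    have e2 : (1 - h2 a) ^ 2 ≤ 1 - h2 a := by nlinarith
    have : h2 a ^ 2 * (1 - h2 a) ^ 2 ≤ h2 (bconv a a) ^ 2 * (1 - h2 a) := by gcongr
    linarith
end

section
/- Let Y₂ and Y₃ be finite types, let P₂ and P₃ be probability mass functions on them, let q₂ : Y₂ → [0,1] and q₃ : Y₃ → [0,1], and set H₂ = ∑_{y₂} P₂(y₂)·h₂(q₂(y₂)) and H₃ = ∑_{y₃} P₃(y₃)·h₂(q₃(y₃)). Then ∑_{y₂} ∑_{y₃} P₂(y₂)·P₃(y₃)·h₂(q₂(y₂)⋆q₃(y₃)) ≤ H₂ + H₃ − H₂·H₃. -/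
noncomputable def Gent (u : ℝ) : ℝ := Real.log 2 - Real.binEntropy ((1 - u) / 2)

noncomputable def cent (k : ℕ) : ℝ := 1 / ((2 * k + 1) * (2 * k + 2))

lemma cent_nonneg (k : ℕ) : 0 ≤ cent k := by unfold cent; positivity

lemma Gent_hasSum {u : ℝ} (hu : |u| < 1) :
    HasSum (fun k : ℕ => cent k * (u ^ 2) ^ (k + 1)) (Gent u) := by
  have h1 := (Real.hasSum_log_sub_log_of_abs_lt_one hu).mul_left u
  have hu2 : |u ^ 2| < 1 := by
    rw [abs_pow]; exact pow_lt_one₀ (abs_nonneg _) hu (by norm_num)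
  have h2 := Real.hasSum_pow_div_log_of_abs_lt_one hu2
  have h3 := (h1.sub h2).mul_left (1 / 2)
  obtain ⟨ha, hb⟩ := abs_lt.mp hu
  have hp : (1 + u) ≠ 0 := by linarith
  have hm : (1 - u) ≠ 0 := by linarith
  convert h3 using 1
  · rfl
  · funext k
    unfold cent
    have e1 : (2 * (k : ℝ) + 1) ≠ 0 := by positivity
    have e2 : (2 * (k : ℝ) + 2) ≠ 0 := by positivity
    have e3 : ((k : ℝ) + 1) ≠ 0 := by positivity
    have e4 : u * (2 * (1 / (2 * (k : ℝ) + 1)) * u ^ (2 * k + 1))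
        = 2 * (1 / (2 * (k : ℝ) + 1)) * (u ^ 2) ^ (k + 1) := by
      rw [← pow_mul]; ring
    rw [e4]
    generalize (u ^ 2) ^ (k + 1) = w
    field_simp
    ring
  · have e : 1 - u ^ 2 = (1 + u) * (1 - u) := by ring
    rw [e, Real.log_mul hp hm]
    unfold Gent
    rw [Real.binEntropy_eq_negMulLog_add_negMulLog_one_sub]
    have e' : 1 - (1 - u) / 2 = (1 + u) / 2 := by ring
    rw [e']
    unfold Real.negMulLog
    rw [Real.log_div hm two_ne_zero, Real.log_div hp two_ne_zero]
    ring

lemma cent_sum_le (n : ℕ) : ∑ k ∈ Finset.range n, cent k ≤ Real.log 2 := by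
  have hc : IsClosed {u : ℝ | ∑ k ∈ Finset.range n, cent k * (u ^ 2) ^ (k + 1) ≤ Gent u} := by
    apply isClosed_le
    · fun_prop
    · unfold Gent; fun_prop
  have hs : Set.Ioo (-1 : ℝ) 1 ⊆
      {u : ℝ | ∑ k ∈ Finset.range n, cent k * (u ^ 2) ^ (k + 1) ≤ Gent u} := by
    intro u hu
    exact sum_le_hasSum _ (fun k _ => mul_nonneg (cent_nonneg k) (by positivity))
      (Gent_hasSum (abs_lt.mpr hu))
  have h := closure_minimal hs hc
  rw [closure_Ioo (by norm_num)] at h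
  have := h (show (1 : ℝ) ∈ Set.Icc (-1 : ℝ) 1 by constructor <;> norm_num)
  simpa [Gent] using this

lemma cheb (n : ℕ) (x y : ℝ) (hx : 0 ≤ x) (hx1 : x ≤ 1) (hy : 0 ≤ y) (hy1 : y ≤ 1) :
    (∑ k ∈ Finset.range n, cent k * x ^ (k + 1)) * (∑ k ∈ Finset.range n, cent k * y ^ (k + 1))
      ≤ (∑ k ∈ Finset.range n, cent k) * ∑ k ∈ Finset.range n, cent k * (x * y) ^ (k + 1) := by
  have key : 0 ≤ ∑ i ∈ Finset.range n, ∑ j ∈ Finset.range n,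
      cent i * cent j * ((x ^ (i + 1) - x ^ (j + 1)) * (y ^ (i + 1) - y ^ (j + 1))) := by
    refine Finset.sum_nonneg fun i _ => Finset.sum_nonneg fun j _ => ?_
    refine mul_nonneg (mul_nonneg (cent_nonneg i) (cent_nonneg j)) ?_
    rcases le_total i j with h | h
    · exact mul_nonneg (sub_nonneg.2 (pow_le_pow_of_le_one hx hx1 (by omega)))
        (sub_nonneg.2 (pow_le_pow_of_le_one hy hy1 (by omega)))
    · exact mul_nonneg_of_nonpos_of_nonpos
        (sub_nonpos.2 (pow_le_pow_of_le_one hx hx1 (by omega)))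
        (sub_nonpos.2 (pow_le_pow_of_le_one hy hy1 (by omega)))
  have e : ∑ i ∈ Finset.range n, ∑ j ∈ Finset.range n,
      cent i * cent j * ((x ^ (i + 1) - x ^ (j + 1)) * (y ^ (i + 1) - y ^ (j + 1)))
      = (∑ k ∈ Finset.range n, cent k * (x * y) ^ (k + 1)) * (∑ k ∈ Finset.range n, cent k)
      + (∑ k ∈ Finset.range n, cent k) * (∑ k ∈ Finset.range n, cent k * (x * y) ^ (k + 1))
      - (∑ k ∈ Finset.range n, cent k * x ^ (k + 1)) * (∑ k ∈ Finset.range n, cent k * y ^ (k + 1))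
      - (∑ k ∈ Finset.range n, cent k * y ^ (k + 1)) *
        (∑ k ∈ Finset.range n, cent k * x ^ (k + 1)) := by
    simp only [Finset.sum_mul_sum, ← Finset.sum_add_distrib, ← Finset.sum_sub_distrib]
    refine Finset.sum_congr rfl fun i _ => Finset.sum_congr rfl fun j _ => ?_
    rw [mul_pow, mul_pow]; ring
  rw [e] at key
  linarith

lemma Gent_mul {u v : ℝ} (hu : |u| ≤ 1) (hv : |v| ≤ 1) :
    Gent u * Gent v ≤ Real.log 2 * Gent (u * v) := by
  have hneg : ∀ t, Gent (-t) = Gent t := by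
    intro t
    unfold Gent
    rw [← Real.binEntropy_one_sub]
    congr 2; ring
  have h1 : Gent 1 = Real.log 2 := by simp [Gent]
  have hone : ∀ s t : ℝ, |s| = 1 → Gent s * Gent t ≤ Real.log 2 * Gent (s * t) := by
    intro s t hs
    rcases eq_or_eq_neg_of_abs_eq hs with h | h
    · rw [h, one_mul, h1]
    · rw [h, neg_one_mul, hneg, hneg, h1]
  rcases hu.lt_or_eq with hu' | hu'
  swap
  · exact hone u v hu'
  rcases hv.lt_or_eq with hv' | hv'
  swap
  · rw [mul_comm u v, mul_comm (Gent u)]; exact hone v u hv'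
  have huv : |u * v| < 1 := by
    rw [abs_mul]; exact mul_lt_one_of_nonneg_of_lt_one_left (abs_nonneg _) hu' hv
  have su := (Gent_hasSum hu').tendsto_sum_nat
  have sv := (Gent_hasSum hv').tendsto_sum_nat
  have suv := (Gent_hasSum huv).tendsto_sum_nat
  refine le_of_tendsto_of_tendsto' (su.mul sv) (suv.const_mul (Real.log 2)) fun n => ?_
  have hx := (sq_le_one_iff_abs_le_one u).2 hu
  have hy := (sq_le_one_iff_abs_le_one v).2 hv
  refine (cheb n (u ^ 2) (v ^ 2) (sq_nonneg _) hx (sq_nonneg _) hy).trans ?_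
  rw [← mul_pow]
  exact mul_le_mul_of_nonneg_right (cent_sum_le n)
    (Finset.sum_nonneg fun k _ => mul_nonneg (cent_nonneg k) (by positivity))

lemma h2_eq (p : ℝ) : h2 p = 1 - Gent (1 - 2 * p) / Real.log 2 := by
  have hl : Real.log 2 ≠ 0 := (Real.log_pos (by norm_num)).ne'
  unfold Gent h2 Real.logb
  have e : (1 - (1 - 2 * p)) / 2 = p := by ring
  rw [e, Real.binEntropy_eq_negMulLog_add_negMulLog_one_sub]
  unfold Real.negMulLog
  field_simp
  ring

lemma h2_bconv_le {a b : ℝ} (ha : a ∈ Set.Icc (0 : ℝ) 1) (hb : b ∈ Set.Icc (0 : ℝ) 1) :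
    h2 (bconv a b) ≤ h2 a + h2 b - h2 a * h2 b := by
  have hl : 0 < Real.log 2 := Real.log_pos (by norm_num)
  have h := Gent_mul (u := 1 - 2 * a) (v := 1 - 2 * b)
    (abs_le.2 ⟨by linarith [ha.2], by linarith [ha.1]⟩)
    (abs_le.2 ⟨by linarith [hb.2], by linarith [hb.1]⟩)
  have e : 1 - 2 * bconv a b = (1 - 2 * a) * (1 - 2 * b) := by unfold bconv; ring
  rw [h2_eq, h2_eq a, h2_eq b, e]
  have : Gent (1 - 2 * a) / Real.log 2 * (Gent (1 - 2 * b) / Real.log 2)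
      ≤ Gent ((1 - 2 * a) * (1 - 2 * b)) / Real.log 2 := by
    rw [div_mul_div_comm, div_le_div_iff₀ (by positivity) hl]
    nlinarith
  linarith

theorem entropy_conv_averaged_upper_bound {Y₂ Y₃ : Type*} [Fintype Y₂] [Fintype Y₃]
    (P₂ : Y₂ → ℝ) (hP₂ : ∀ y, 0 ≤ P₂ y) (hP₂sum : ∑ y, P₂ y = 1)
    (P₃ : Y₃ → ℝ) (hP₃ : ∀ y, 0 ≤ P₃ y) (hP₃sum : ∑ y, P₃ y = 1)
    (q₂ : Y₂ → ℝ) (hq₂ : ∀ y, q₂ y ∈ Set.Icc (0 : ℝ) 1)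
    (q₃ : Y₃ → ℝ) (hq₃ : ∀ y, q₃ y ∈ Set.Icc (0 : ℝ) 1) :
    ∑ y₂, ∑ y₃, P₂ y₂ * P₃ y₃ * h2 (bconv (q₂ y₂) (q₃ y₃)) ≤
      (∑ y, P₂ y * h2 (q₂ y)) + (∑ y, P₃ y * h2 (q₃ y)) -
        (∑ y, P₂ y * h2 (q₂ y)) * (∑ y, P₃ y * h2 (q₃ y)) := by
  calc _ ≤ ∑ y₂, ∑ y₃, P₂ y₂ * P₃ y₃ *
        (h2 (q₂ y₂) + h2 (q₃ y₃) - h2 (q₂ y₂) * h2 (q₃ y₃)) :=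
        Finset.sum_le_sum fun i _ => Finset.sum_le_sum fun j _ =>
          mul_le_mul_of_nonneg_left (h2_bconv_le (hq₂ i) (hq₃ j)) (mul_nonneg (hP₂ i) (hP₃ j))
    _ = (∑ y, P₂ y * h2 (q₂ y)) * (∑ y, P₃ y) + (∑ y, P₂ y) * (∑ y, P₃ y * h2 (q₃ y)) -
        (∑ y, P₂ y * h2 (q₂ y)) * (∑ y, P₃ y * h2 (q₃ y)) := by
        simp only [Finset.sum_mul_sum, ← Finset.sum_add_distrib, ← Finset.sum_sub_distrib]
        refine Finset.sum_congr rfl fun i _ => Finset.sum_congr rfl fun j _ => ?_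
        ring
    _ = _ := by rw [hP₂sum, hP₃sum, mul_one, one_mul]
end
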